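/- Let n ≥ 3 and let 𝒰⁺_{q,n} be the ℂ(q)-algebra presented by generators u_1,…,u_{n−1}, w, z and relations: [u_i,[u_i,u_j]_q]_{q^{−1}}=0 if |i−j|=1; u_iu_j=u_ju_i if |i−j|>1; u_iw=wu_i for i≠1; u_iz=zu_i for i≠2; zw=wz; [u_1,[u_1,[u_1,w]]_{q²}]_{q^{−2}}=0; [u_2,[u_2,z]_q]_{q^{−1}}=0; [w,[w,u_1]_{q²}]_{q^{−2}}=−h·wz; [z,[u_2,[u_1,w]_{q²}]_q]_q=[w,[u_1,[u_2,z]_q]_q]_{q²}; and 2[z,[z,u_2]_q]_{q^{−1}}=h(z[u_1,u_2]_q w + w[u_2,u_1]_{q^{−1}} z + wu_1[z,u_2]_q + [u_2,z]_{q^{−1}}u_1w), where h=q−q^{−1}. Let U_q^+(so_{2n+2}) be the ℂ(q)-algebra presented by generators E_{−1},E_0,E_1,…,E_{n−1} with relations E_iE_j=E_jE_i when a_{ij}=0 and E_i²E_j−(q+q^{−1})E_iE_jE_i+E_jE_i²=0 when a_{ij}=−1, for the D_{n+1} Cartan matrix in which nodes −1 and 0 are each joined to node 1 and nodes 1,2,…,n−1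 form a chain. Then the assignment u_i ↦ E_i (1≤i≤n−1), w ↦ E_0E_{−1}, z ↦ (q²−1)^{−1}([E_{−1},[E_1,E_0]_q]_q + [E_0,[E_1,E_{−1}]_q]_q) extends to a ℂ(q)-algebra homomorphism 𝒰⁺_{q,n} → U_q^+(so_{2n+2}). -/

import Mathlib

noncomputable section

/-- The field `ℂ(q)` of rational functions. -/
abbrev Kq := RatFunc ℂ
/-- The variable `q`. -/
def qq : Kq := RatFunc.X

/-- The deformed commutator `[a,b]_v = ab − v·ba` in any `ℂ(q)`-algebra. -/
def cmt {A : Type*} [Ring A] [Algebra Kq A] (a b : A) (v : Kq) : A := a * b - v • (b * a)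

/-- Generators `u_1, …, u_{n−1}, w, z` of `𝒰⁺_{q,n}`; `u i` stands for `u_{i+1}`. -/
inductive UGen (n : ℕ)
  | u (i : Fin (n - 1))
  | w
  | z

variable (n : ℕ)

/-- The generator `u_{i+1}` in the free algebra. -/
def fu (i : Fin (n - 1)) : FreeAlgebra Kq (UGen n) := FreeAlgebra.ι Kq (UGen.u i)
/-- The generator `w` in the free algebra. -/
def fw : FreeAlgebra Kq (UGen n) := FreeAlgebra.ι Kq UGen.w
/-- The generator `z` in the free algebra. -/
def fz : FreeAlgebra Kq (UGen n) := FreeAlgebra.ι Kq UGen.z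

/-- The defining relations of the algebra `𝒰⁺_{q,n}` (the uberalgebra of the quantum folding
`(so_{2n+2}, sp_{2n})`), in the generators `u_1,…,u_{n−1}, w, z`.  Here the generator `u i`
represents `u_{i+1}` and `[a,b]_v = ab − v·ba`. -/
inductive URel : FreeAlgebra Kq (UGen n) → FreeAlgebra Kq (UGen n) → Prop
  | serre_u (i j : Fin (n - 1)) :
      (i : ℕ) + 1 = (j : ℕ) ∨ (j : ℕ) + 1 = (i : ℕ) →
      URel (cmt (fu n i) (cmt (fu n i) (fu n j) qq) qq⁻¹) 0
  | comm_u (i j : Fin (n - 1)) :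
      (i : ℕ) + 1 < (j : ℕ) ∨ (j : ℕ) + 1 < (i : ℕ) →
      URel (fu n i * fu n j) (fu n j * fu n i)
  | comm_uw (i : Fin (n - 1)) : (i : ℕ) ≠ 0 → URel (fu n i * fw n) (fw n * fu n i)
  | comm_uz (i : Fin (n - 1)) : (i : ℕ) ≠ 1 → URel (fu n i * fz n) (fz n * fu n i)
  | comm_zw : URel (fz n * fw n) (fw n * fz n)
  | serre_u1w (i : Fin (n - 1)) : (i : ℕ) = 0 →
      URel (cmt (fu n i) (cmt (fu n i) (cmt (fu n i) (fw n) 1) (qq ^ 2)) (qq⁻¹ ^ 2)) 0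
  | serre_u2z (i : Fin (n - 1)) : (i : ℕ) = 1 →
      URel (cmt (fu n i) (cmt (fu n i) (fz n) qq) qq⁻¹) 0
  | rel_wwu (i : Fin (n - 1)) : (i : ℕ) = 0 →
      URel (cmt (fw n) (cmt (fw n) (fu n i) (qq ^ 2)) (qq⁻¹ ^ 2))
        (-((qq - qq⁻¹) • (fw n * fz n)))
  | rel_zw (i j : Fin (n - 1)) : (i : ℕ) = 0 → (j : ℕ) = 1 →
      URel (cmt (fz n) (cmt (fu n j) (cmt (fu n i) (fw n) (qq ^ 2)) qq) qq)
        (cmt (fw n) (cmt (fu n i) (cmt (fu n j) (fz n) qq) qq) (qq ^ 2))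
  | rel_zz (i j : Fin (n - 1)) : (i : ℕ) = 0 → (j : ℕ) = 1 →
      URel ((2 : Kq) • cmt (fz n) (cmt (fz n) (fu n j) qq) qq⁻¹)
        ((qq - qq⁻¹) •
          (fz n * cmt (fu n i) (fu n j) qq * fw n
            + fw n * cmt (fu n j) (fu n i) qq⁻¹ * fz n
            + fw n * fu n i * cmt (fz n) (fu n j) qq
            + cmt (fu n j) (fz n) qq⁻¹ * fu n i * fw n))

/-- The algebra `𝒰⁺_{q,n}`. -/
abbrev UqnPlus := RingQuot (URel n)

/-- The nodes of the Dynkin diagram `D_{n+1}`: nodes `−1` and `0` are each joined to node `1`,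
and nodes `1, …, n−1` form a chain (`pos i` stands for the node `i+1`). -/
inductive DNode (n : ℕ)
  | neg
  | zer
  | pos (i : Fin (n - 1))

/-- Adjacency in the Dynkin diagram `D_{n+1}`. -/
def adjD : DNode n → DNode n → Prop
  | .neg, .pos i => (i : ℕ) = 0
  | .pos i, .neg => (i : ℕ) = 0
  | .zer, .pos i => (i : ℕ) = 0
  | .pos i, .zer => (i : ℕ) = 0
  | .pos i, .pos j => (i : ℕ) + 1 = (j : ℕ) ∨ (j : ℕ) + 1 = (i : ℕ)
  | _, _ => False

/-- The generator `E_x` of the free algebra on the nodes of `D_{n+1}`. -/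
def fE (x : DNode n) : FreeAlgebra Kq (DNode n) := FreeAlgebra.ι Kq x

/-- The defining relations of `U_q^+(so_{2n+2})`: generators commute at non-adjacent nodes, and
satisfy the quantum Serre relations at adjacent nodes. -/
inductive SORel : FreeAlgebra Kq (DNode n) → FreeAlgebra Kq (DNode n) → Prop
  | comm (x y : DNode n) : x ≠ y → ¬ adjD n x y → SORel (fE n x * fE n y) (fE n y * fE n x)
  | serre (x y : DNode n) : adjD n x y →
      SORel (fE n x * fE n x * fE n y + fE n y * fE n x * fE n x)
        ((qq + qq⁻¹) • (fE n x * fE n y * fE n x))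

/-- `U_q^+(so_{2n+2})`. -/
abbrev UqSO := RingQuot (SORel n)

/-- The generator `E_x` of `U_q^+(so_{2n+2})`. -/
def mE (x : DNode n) : UqSO n := RingQuot.mkAlgHom Kq (SORel n) (fE n x)

set_option linter.unusedSimpArgs false
set_option linter.unusedVariables false
set_option linter.unusedTactic false
set_option linter.unreachableTactic false

/-- Serre-type relations for `D_4`, as rewriting rules (with `s = q + q⁻¹`). -/
structure D4Rules {K A : Type*} [Field K] [Ring A] [Algebra K A] (s : K) (a b c d : A) : Prop where
  db : d * (b) = b * (d)
  da : d * (a) = a * (d)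
  ba : b * (a) = a * (b)
  dcc : d * (c * (c)) = s • (c * (d * (c))) - c * (c * (d))
  ccb : c * (c * (b)) = s • (c * (b * (c))) - b * (c * (c))
  cbb : c * (b * (b)) = s • (b * (c * (b))) - b * (b * (c))
  cca : c * (c * (a)) = s • (c * (a * (c))) - a * (c * (c))
  caa : c * (a * (a)) = s • (a * (c * (a))) - a * (a * (c))
  ddc : d * (d * (c)) = s • (d * (c * (d))) - c * (d * (d))

namespace D4Rules

variable {K A : Type*} [Field K] [Ring A] [Algebra K A] {s : K} {a b c d : A}

theorem ddc_x (h : D4Rules s a b c d) (x : A) :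
    d * (d * (c * (x))) =
      s • (d * (c * (d * (x)))) - c * (d * (d * (x))) := by
  have h1 := congrArg (· * x) (h.ddc)
  simpa only [mul_assoc, mul_add, add_mul, mul_sub, sub_mul, smul_mul_assoc, mul_smul_comm,
      smul_add, smul_sub, smul_smul, neg_mul, mul_neg, smul_neg] using h1

theorem db_x (h : D4Rules s a b c d) (x : A) :
    d * (b * (x)) =
      b * (d * (x)) := by
  have h1 := congrArg (· * x) (h.db)
  simpa only [mul_assoc, mul_add, add_mul, mul_sub, sub_mul, smul_mul_assoc, mul_smul_comm,
      smul_add, smul_sub, smul_smul, neg_mul, mul_neg, smul_neg] using h1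

theorem da_x (h : D4Rules s a b c d) (x : A) :
    d * (a * (x)) =
      a * (d * (x)) := by
  have h1 := congrArg (· * x) (h.da)
  simpa only [mul_assoc, mul_add, add_mul, mul_sub, sub_mul, smul_mul_assoc, mul_smul_comm,
      smul_add, smul_sub, smul_smul, neg_mul, mul_neg, smul_neg] using h1

theorem ba_x (h : D4Rules s a b c d) (x : A) :
    b * (a * (x)) =
      a * (b * (x)) := by
  have h1 := congrArg (· * x) (h.ba)
  simpa only [mul_assoc, mul_add, add_mul, mul_sub, sub_mul, smul_mul_assoc, mul_smul_comm,
      smul_add, smul_sub, smul_smul, neg_mul, mul_neg, smul_neg] using h1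

theorem dcc_x (h : D4Rules s a b c d) (x : A) :
    d * (c * (c * (x))) =
      s • (c * (d * (c * (x)))) - c * (c * (d * (x))) := by
  have h1 := congrArg (· * x) (h.dcc)
  simpa only [mul_assoc, mul_add, add_mul, mul_sub, sub_mul, smul_mul_assoc, mul_smul_comm,
      smul_add, smul_sub, smul_smul, neg_mul, mul_neg, smul_neg] using h1

theorem ccb_x (h : D4Rules s a b c d) (x : A) :
    c * (c * (b * (x))) =
      s • (c * (b * (c * (x)))) - b * (c * (c * (x))) := by
  have h1 := congrArg (· * x) (h.ccb)
  simpa only [mul_assoc, mul_add, add_mul, mul_sub, sub_mul, smul_mul_assoc, mul_smul_comm,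
      smul_add, smul_sub, smul_smul, neg_mul, mul_neg, smul_neg] using h1

theorem cbb_x (h : D4Rules s a b c d) (x : A) :
    c * (b * (b * (x))) =
      s • (b * (c * (b * (x)))) - b * (b * (c * (x))) := by
  have h1 := congrArg (· * x) (h.cbb)
  simpa only [mul_assoc, mul_add, add_mul, mul_sub, sub_mul, smul_mul_assoc, mul_smul_comm,
      smul_add, smul_sub, smul_smul, neg_mul, mul_neg, smul_neg] using h1

theorem cca_x (h : D4Rules s a b c d) (x : A) :
    c * (c * (a * (x))) =
      s • (c * (a * (c * (x)))) - a * (c * (c * (x))) := by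
  have h1 := congrArg (· * x) (h.cca)
  simpa only [mul_assoc, mul_add, add_mul, mul_sub, sub_mul, smul_mul_assoc, mul_smul_comm,
      smul_add, smul_sub, smul_smul, neg_mul, mul_neg, smul_neg] using h1

theorem caa_x (h : D4Rules s a b c d) (x : A) :
    c * (a * (a * (x))) =
      s • (a * (c * (a * (x)))) - a * (a * (c * (x))) := by
  have h1 := congrArg (· * x) (h.caa)
  simpa only [mul_assoc, mul_add, add_mul, mul_sub, sub_mul, smul_mul_assoc, mul_smul_comm,
      smul_add, smul_sub, smul_smul, neg_mul, mul_neg, smul_neg] using h1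

set_option maxHeartbeats 1000000 in
theorem dcbc (h : D4Rules s a b c d) (hs : s ≠ 0) :
    d * (c * (b * (c))) =
      c * (d * (c * (b))) - c * (b * (c * (d))) + b * (c * (d * (c))) := by
  have h1 : (d * (c * c)) * b = d * (c * (c * b)) := by
    simp only [mul_assoc]
  rw [h.dcc, h.ccb] at h1
  simp only [mul_assoc, mul_add, add_mul, mul_sub, sub_mul, smul_mul_assoc, mul_smul_comm,
      smul_add, smul_sub, smul_smul, neg_mul, mul_neg, smul_neg, h.db, h.db_x, h.da, h.da_x, h.ba,
      h.ba_x, h.dcc, h.dcc_x, h.ccb, h.ccb_x, h.cbb, h.cbb_x, h.cca, h.cca_x, h.caa, h.caa_x] at h1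
  rw [← sub_eq_zero]
  refine (smul_eq_zero_iff_right hs).1 ?_
  rw [← sub_eq_zero] at h1
  first
    | (rw [← h1]; module)
    | (rw [← neg_eq_zero, ← h1]; module)

theorem dcbc_x (h : D4Rules s a b c d) (hs : s ≠ 0) (x : A) :
    d * (c * (b * (c * (x)))) =
      c * (d * (c * (b * (x)))) - c * (b * (c * (d * (x)))) + b * (c * (d * (c * (x)))) := by
  have h1 := congrArg (· * x) (h.dcbc hs)
  simpa only [mul_assoc, mul_add, add_mul, mul_sub, sub_mul, smul_mul_assoc, mul_smul_comm,
      smul_add, smul_sub, smul_smul, neg_mul, mul_neg, smul_neg] using h1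

set_option maxHeartbeats 1000000 in
theorem dcac (h : D4Rules s a b c d) (hs : s ≠ 0) :
    d * (c * (a * (c))) =
      c * (d * (c * (a))) - c * (a * (c * (d))) + a * (c * (d * (c))) := by
  have h1 : (d * (c * c)) * a = d * (c * (c * a)) := by
    simp only [mul_assoc]
  rw [h.dcc, h.cca] at h1
  simp only [mul_assoc, mul_add, add_mul, mul_sub, sub_mul, smul_mul_assoc, mul_smul_comm,
      smul_add, smul_sub, smul_smul, neg_mul, mul_neg, smul_neg, h.db, h.db_x, h.da, h.da_x, h.ba,
      h.ba_x, h.dcc, h.dcc_x, h.ccb, h.ccb_x, h.cbb, h.cbb_x, h.cca, h.cca_x, h.caa, h.caa_x,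
      h.dcbc hs, h.dcbc_x hs] at h1
  rw [← sub_eq_zero]
  refine (smul_eq_zero_iff_right hs).1 ?_
  rw [← sub_eq_zero] at h1
  first
    | (rw [← h1]; module)
    | (rw [← neg_eq_zero, ← h1]; module)

theorem dcac_x (h : D4Rules s a b c d) (hs : s ≠ 0) (x : A) :
    d * (c * (a * (c * (x)))) =
      c * (d * (c * (a * (x)))) - c * (a * (c * (d * (x)))) + a * (c * (d * (c * (x)))) := by
  have h1 := congrArg (· * x) (h.dcac hs)
  simpa only [mul_assoc, mul_add, add_mul, mul_sub, sub_mul, smul_mul_assoc, mul_smul_comm,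
      smul_add, smul_sub, smul_smul, neg_mul, mul_neg, smul_neg] using h1

set_option maxHeartbeats 1000000 in
theorem cbca (h : D4Rules s a b c d) (hs : s ≠ 0) :
    c * (b * (c * (a))) =
      c * (a * (c * (b))) + b * (c * (a * (c))) - a * (c * (b * (c))) := by
  have h1 : (c * (c * b)) * a = (c * (c * a)) * b := by
    simp only [mul_assoc, h.ba]
  rw [h.ccb, h.cca] at h1
  simp only [mul_assoc, mul_add, add_mul, mul_sub, sub_mul, smul_mul_assoc, mul_smul_comm,
      smul_add, smul_sub, smul_smul, neg_mul, mul_neg, smul_neg, h.db, h.db_x, h.da, h.da_x, h.ba,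
      h.ba_x, h.dcc, h.dcc_x, h.ccb, h.ccb_x, h.cbb, h.cbb_x, h.cca, h.cca_x, h.caa, h.caa_x,
      h.dcbc hs, h.dcbc_x hs, h.dcac hs, h.dcac_x hs] at h1
  rw [← sub_eq_zero]
  refine (smul_eq_zero_iff_right hs).1 ?_
  rw [← sub_eq_zero] at h1
  first
    | (rw [← h1]; module)
    | (rw [← neg_eq_zero, ← h1]; module)

theorem cbca_x (h : D4Rules s a b c d) (hs : s ≠ 0) (x : A) :
    c * (b * (c * (a * (x)))) =
      c * (a * (c * (b * (x)))) + b * (c * (a * (c * (x)))) - a * (c * (b * (c * (x)))) := by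
  have h1 := congrArg (· * x) (h.cbca hs)
  simpa only [mul_assoc, mul_add, add_mul, mul_sub, sub_mul, smul_mul_assoc, mul_smul_comm,
      smul_add, smul_sub, smul_smul, neg_mul, mul_neg, smul_neg] using h1

set_option maxHeartbeats 1000000 in
theorem cabb (h : D4Rules s a b c d) (hs : s ≠ 0) :
    c * (a * (b * (b))) =
      s • (b * (c * (a * (b)))) - b * (b * (c * (a))) := by
  have h1 : (c * (b * b)) * a = c * (a * (b * b)) := by
    simp only [mul_assoc, h.ba, h.ba_x]
  rw [h.cbb] at h1
  simp only [mul_assoc, mul_add, add_mul, mul_sub, sub_mul, smul_mul_assoc, mul_smul_comm,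
      smul_add, smul_sub, smul_smul, neg_mul, mul_neg, smul_neg, h.db, h.db_x, h.da, h.da_x, h.ba,
      h.ba_x, h.dcc, h.dcc_x, h.ccb, h.ccb_x, h.cbb, h.cbb_x, h.cca, h.cca_x, h.caa, h.caa_x,
      h.dcbc hs, h.dcbc_x hs, h.dcac hs, h.dcac_x hs, h.cbca hs, h.cbca_x hs] at h1
  rw [← h1]

theorem cabb_x (h : D4Rules s a b c d) (hs : s ≠ 0) (x : A) :
    c * (a * (b * (b * (x)))) =
      s • (b * (c * (a * (b * (x))))) - b * (b * (c * (a * (x)))) := by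
  have h1 := congrArg (· * x) (h.cabb hs)
  simpa only [mul_assoc, mul_add, add_mul, mul_sub, sub_mul, smul_mul_assoc, mul_smul_comm,
      smul_add, smul_sub, smul_smul, neg_mul, mul_neg, smul_neg] using h1

set_option maxHeartbeats 1000000 in
theorem cacab (h : D4Rules s a b c d) (hs : s ≠ 0) :
    c * (a * (c * (a * (b)))) =
      s • (c * (a * (b * (c * (a))))) - b * (c * (a * (c * (a)))) + a * (c * (a * (c * (b)))) - s
          • (a * (c * (a * (b * (c))))) + a * (b * (c * (a * (c)))) := by
  have h1 : (c * (b * (c * a))) * a = c * (b * (c * (a * a))) := by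
    simp only [mul_assoc]
  rw [h.cbca hs, h.caa] at h1
  simp only [mul_assoc, mul_add, add_mul, mul_sub, sub_mul, smul_mul_assoc, mul_smul_comm,
      smul_add, smul_sub, smul_smul, neg_mul, mul_neg, smul_neg, h.db, h.db_x, h.da, h.da_x, h.ba,
      h.ba_x, h.dcc, h.dcc_x, h.ccb, h.ccb_x, h.cbb, h.cbb_x, h.cca, h.cca_x, h.caa, h.caa_x,
      h.dcbc hs, h.dcbc_x hs, h.dcac hs, h.dcac_x hs, h.cbca hs, h.cbca_x hs, h.cabb hs, h.cabb_x
      hs] at h1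
  rw [← sub_eq_zero] at h1
  rw [← sub_eq_zero]
  first
    | (rw [← h1]; module)
    | (rw [← neg_eq_zero, ← h1]; module)

theorem cacab_x (h : D4Rules s a b c d) (hs : s ≠ 0) (x : A) :
    c * (a * (c * (a * (b * (x))))) =
      s • (c * (a * (b * (c * (a * (x)))))) - b * (c * (a * (c * (a * (x))))) + a * (c * (a * (c *
          (b * (x))))) - s • (a * (c * (a * (b * (c * (x)))))) + a * (b * (c * (a * (c * (x)))))
          := by
  have h1 := congrArg (· * x) (h.cacab hs)
  simpa only [mul_assoc, mul_add, add_mul, mul_sub, sub_mul, smul_mul_assoc, mul_smul_comm,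
      smul_add, smul_sub, smul_smul, neg_mul, mul_neg, smul_neg] using h1

set_option maxHeartbeats 1000000 in
theorem dcabcb (h : D4Rules s a b c d) (hs : s ≠ 0) :
    d * (c * (a * (b * (c * (b))))) =
      c * (b * (d * (c * (a * (b))))) - c * (a * (b * (c * (b * (d))))) + b * (d * (c * (a * (b *
          (c))))) - b * (c * (b * (d * (c * (a))))) + b * (c * (a * (b * (c * (d))))) + a * (c *
          (b * (d * (c * (b))))) - a * (b * (c * (b * (d * (c))))) := by
  have h1 : (d * (c * (a * c))) * (b * b) = d * (c * (a * (c * (b * b)))) := by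
    simp only [mul_assoc]
  rw [h.dcac hs, h.cbb] at h1
  simp only [mul_assoc, mul_add, add_mul, mul_sub, sub_mul, smul_mul_assoc, mul_smul_comm,
      smul_add, smul_sub, smul_smul, neg_mul, mul_neg, smul_neg, h.db, h.db_x, h.da, h.da_x, h.ba,
      h.ba_x, h.dcc, h.dcc_x, h.ccb, h.ccb_x, h.cbb, h.cbb_x, h.cca, h.cca_x, h.caa, h.caa_x,
      h.dcbc hs, h.dcbc_x hs, h.dcac hs, h.dcac_x hs, h.cbca hs, h.cbca_x hs, h.cabb hs, h.cabb_x
      hs, h.cacab hs, h.cacab_x hs] at h1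
  rw [← sub_eq_zero]
  refine (smul_eq_zero_iff_right hs).1 ?_
  rw [← sub_eq_zero] at h1
  first
    | (rw [← h1]; module)
    | (rw [← neg_eq_zero, ← h1]; module)

theorem dcabcb_x (h : D4Rules s a b c d) (hs : s ≠ 0) (x : A) :
    d * (c * (a * (b * (c * (b * (x)))))) =
      c * (b * (d * (c * (a * (b * (x)))))) - c * (a * (b * (c * (b * (d * (x)))))) + b * (d * (c
          * (a * (b * (c * (x)))))) - b * (c * (b * (d * (c * (a * (x)))))) + b * (c * (a * (b *
          (c * (d * (x)))))) + a * (c * (b * (d * (c * (b * (x)))))) - a * (b * (c * (b * (d * (c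
          * (x)))))) := by
  have h1 := congrArg (· * x) (h.dcabcb hs)
  simpa only [mul_assoc, mul_add, add_mul, mul_sub, sub_mul, smul_mul_assoc, mul_smul_comm,
      smul_add, smul_sub, smul_smul, neg_mul, mul_neg, smul_neg] using h1

set_option maxHeartbeats 1000000 in
theorem dcabca (h : D4Rules s a b c d) (hs : s ≠ 0) :
    d * (c * (a * (b * (c * (a))))) =
      c * (a * (d * (c * (a * (b))))) - c * (a * (b * (c * (a * (d))))) + b * (c * (a * (d * (c *
          (a))))) + a * (d * (c * (a * (b * (c))))) - a * (c * (a * (d * (c * (b))))) + a * (c *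
          (a * (b * (c * (d))))) - a * (b * (c * (a * (d * (c))))) := by
  have h1 : (d * (c * (a * c))) * (a * b) = d * (c * (a * (c * (a * b)))) := by
    simp only [mul_assoc]
  rw [h.dcac hs, h.cacab hs] at h1
  simp only [mul_assoc, mul_add, add_mul, mul_sub, sub_mul, smul_mul_assoc, mul_smul_comm,
      smul_add, smul_sub, smul_smul, neg_mul, mul_neg, smul_neg, h.db, h.db_x, h.da, h.da_x, h.ba,
      h.ba_x, h.dcc, h.dcc_x, h.ccb, h.ccb_x, h.cbb, h.cbb_x, h.cca, h.cca_x, h.caa, h.caa_x,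
      h.dcbc hs, h.dcbc_x hs, h.dcac hs, h.dcac_x hs, h.cbca hs, h.cbca_x hs, h.cabb hs, h.cabb_x
      hs, h.cacab hs, h.cacab_x hs, h.dcabcb hs, h.dcabcb_x hs] at h1
  rw [← sub_eq_zero]
  refine (smul_eq_zero_iff_right hs).1 ?_
  rw [← sub_eq_zero] at h1
  first
    | (rw [← h1]; module)
    | (rw [← neg_eq_zero, ← h1]; module)

theorem dcabca_x (h : D4Rules s a b c d) (hs : s ≠ 0) (x : A) :
    d * (c * (a * (b * (c * (a * (x)))))) =
      c * (a * (d * (c * (a * (b * (x)))))) - c * (a * (b * (c * (a * (d * (x)))))) + b * (c * (a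
          * (d * (c * (a * (x)))))) + a * (d * (c * (a * (b * (c * (x)))))) - a * (c * (a * (d *
          (c * (b * (x)))))) + a * (c * (a * (b * (c * (d * (x)))))) - a * (b * (c * (a * (d * (c
          * (x)))))) := by
  have h1 := congrArg (· * x) (h.dcabca hs)
  simpa only [mul_assoc, mul_add, add_mul, mul_sub, sub_mul, smul_mul_assoc, mul_smul_comm,
      smul_add, smul_sub, smul_smul, neg_mul, mul_neg, smul_neg] using h1

/-- The deformed commutator. -/
def cm (x y : A) (v : K) : A := x * y - v • (y * x)

/-- The image of `z`. -/
def zE (q : K) (a b c : A) : A := (q ^ 2 - 1)⁻¹ • (cm b (cm c a q) q + cm a (cm c b q) q)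

variable {q : K}

theorem u2z (h : D4Rules (q + q⁻¹) a b c d) (hq : q ≠ 0) :
    cm d (cm d (zE q a b c) q) q⁻¹ = 0 := by
  simp only [cm, zE]
  simp only [mul_assoc, mul_add, add_mul, mul_sub, sub_mul, smul_mul_assoc, mul_smul_comm,
      smul_add, smul_sub, smul_smul, neg_mul, mul_neg, smul_neg, h.db, h.db_x, h.da, h.da_x, h.ba,
      h.ba_x, h.ddc, h.ddc_x]
  match_scalars <;> field_simp <;> ring

theorem comm_z {e : A} (ha : e * a = a * e) (hb : e * b = b * e) (hc : e * c = c * e) :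
    e * zE q a b c = zE q a b c * e := by
  have Ha : Commute e a := ha
  have Hb : Commute e b := hb
  have Hc : Commute e c := hc
  have key : ∀ (x y : A) (v : K), Commute e x → Commute e y → Commute e (cm x y v) :=
    fun x y v hx hy => (hx.mul_right hy).sub_right ((hy.mul_right hx).smul_right v)
  exact ((key _ _ _ Hb (key _ _ _ Hc Ha)).add_right
    (key _ _ _ Ha (key _ _ _ Hc Hb))).smul_right _

set_option maxHeartbeats 4000000 in
theorem cz (h : D4Rules (q + q⁻¹) a b c d) (hq : q ≠ 0) (hs : q + q⁻¹ ≠ 0)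
    (hk : q ^ 2 - 1 ≠ 0) :
    c * zE q a b c = zE q a b c * c := by
  rw [← sub_eq_zero]
  simp only [cm, zE]
  simp only [mul_assoc, mul_add, add_mul, mul_sub, sub_mul, smul_mul_assoc, mul_smul_comm,
      smul_add, smul_sub, smul_smul, neg_mul, mul_neg, smul_neg, h.db, h.db_x, h.da, h.da_x, h.ba,
      h.ba_x, h.dcc, h.dcc_x, h.ccb, h.ccb_x, h.cbb, h.cbb_x, h.cca, h.cca_x, h.caa, h.caa_x,
      h.dcbc hs, h.dcbc_x hs, h.dcac hs, h.dcac_x hs, h.cbca hs, h.cbca_x hs, h.cabb hs, h.cabb_x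
      hs, h.cacab hs, h.cacab_x hs, h.dcabcb hs, h.dcabcb_x hs, h.dcabca hs, h.dcabca_x hs]
  match_scalars <;> field_simp <;> ring

set_option maxHeartbeats 4000000 in
theorem zw (h : D4Rules (q + q⁻¹) a b c d) (hq : q ≠ 0) (hs : q + q⁻¹ ≠ 0)
    (hk : q ^ 2 - 1 ≠ 0) :
    zE q a b c * (a * b) = (a * b) * zE q a b c := by
  rw [← sub_eq_zero]
  simp only [cm, zE]
  simp only [mul_assoc, mul_add, add_mul, mul_sub, sub_mul, smul_mul_assoc, mul_smul_comm,
      smul_add, smul_sub, smul_smul, neg_mul, mul_neg, smul_neg, h.db, h.db_x, h.da, h.da_x, h.ba,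
      h.ba_x, h.dcc, h.dcc_x, h.ccb, h.ccb_x, h.cbb, h.cbb_x, h.cca, h.cca_x, h.caa, h.caa_x,
      h.dcbc hs, h.dcbc_x hs, h.dcac hs, h.dcac_x hs, h.cbca hs, h.cbca_x hs, h.cabb hs, h.cabb_x
      hs, h.cacab hs, h.cacab_x hs, h.dcabcb hs, h.dcabcb_x hs, h.dcabca hs, h.dcabca_x hs]
  match_scalars <;> field_simp <;> ring

set_option maxHeartbeats 4000000 in
theorem u1w (h : D4Rules (q + q⁻¹) a b c d) (hq : q ≠ 0) (hs : q + q⁻¹ ≠ 0)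
    (hk : q ^ 2 - 1 ≠ 0) :
    cm c (cm c (cm c (a * b) (1 : K)) (q ^ 2)) (q⁻¹ ^ 2) = 0 := by
  rw [← sub_eq_zero]
  simp only [cm, zE]
  simp only [mul_assoc, mul_add, add_mul, mul_sub, sub_mul, smul_mul_assoc, mul_smul_comm,
      smul_add, smul_sub, smul_smul, neg_mul, mul_neg, smul_neg, h.db, h.db_x, h.da, h.da_x, h.ba,
      h.ba_x, h.dcc, h.dcc_x, h.ccb, h.ccb_x, h.cbb, h.cbb_x, h.cca, h.cca_x, h.caa, h.caa_x,
      h.dcbc hs, h.dcbc_x hs, h.dcac hs, h.dcac_x hs, h.cbca hs, h.cbca_x hs, h.cabb hs, h.cabb_x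
      hs, h.cacab hs, h.cacab_x hs, h.dcabcb hs, h.dcabcb_x hs, h.dcabca hs, h.dcabca_x hs]
  match_scalars <;> field_simp <;> ring

set_option maxHeartbeats 4000000 in
theorem wwu (h : D4Rules (q + q⁻¹) a b c d) (hq : q ≠ 0) (hs : q + q⁻¹ ≠ 0)
    (hk : q ^ 2 - 1 ≠ 0) :
    cm (a * b) (cm (a * b) c (q ^ 2)) (q⁻¹ ^ 2) = -((q - q⁻¹) • ((a * b) * zE q a b c)) := by
  rw [← sub_eq_zero]
  simp only [cm, zE]
  simp only [mul_assoc, mul_add, add_mul, mul_sub, sub_mul, smul_mul_assoc, mul_smul_comm,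
      smul_add, smul_sub, smul_smul, neg_mul, mul_neg, smul_neg, h.db, h.db_x, h.da, h.da_x, h.ba,
      h.ba_x, h.dcc, h.dcc_x, h.ccb, h.ccb_x, h.cbb, h.cbb_x, h.cca, h.cca_x, h.caa, h.caa_x,
      h.dcbc hs, h.dcbc_x hs, h.dcac hs, h.dcac_x hs, h.cbca hs, h.cbca_x hs, h.cabb hs, h.cabb_x
      hs, h.cacab hs, h.cacab_x hs, h.dcabcb hs, h.dcabcb_x hs, h.dcabca hs, h.dcabca_x hs]
  match_scalars <;> field_simp <;> ring

set_option maxHeartbeats 4000000 in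
theorem zw2 (h : D4Rules (q + q⁻¹) a b c d) (hq : q ≠ 0) (hs : q + q⁻¹ ≠ 0)
    (hk : q ^ 2 - 1 ≠ 0) :
    cm (zE q a b c) (cm d (cm c (a * b) (q ^ 2)) q) q
      = cm (a * b) (cm c (cm d (zE q a b c) q) q) (q ^ 2) := by
  rw [← sub_eq_zero]
  simp only [cm, zE]
  simp only [mul_assoc, mul_add, add_mul, mul_sub, sub_mul, smul_mul_assoc, mul_smul_comm,
      smul_add, smul_sub, smul_smul, neg_mul, mul_neg, smul_neg, h.db, h.db_x, h.da, h.da_x, h.ba,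
      h.ba_x, h.dcc, h.dcc_x, h.ccb, h.ccb_x, h.cbb, h.cbb_x, h.cca, h.cca_x, h.caa, h.caa_x,
      h.dcbc hs, h.dcbc_x hs, h.dcac hs, h.dcac_x hs, h.cbca hs, h.cbca_x hs, h.cabb hs, h.cabb_x
      hs, h.cacab hs, h.cacab_x hs, h.dcabcb hs, h.dcabcb_x hs, h.dcabca hs, h.dcabca_x hs]
  match_scalars <;> field_simp <;> ring

set_option maxHeartbeats 4000000 in
theorem zz (h : D4Rules (q + q⁻¹) a b c d) (hq : q ≠ 0) (hs : q + q⁻¹ ≠ 0)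
    (hk : q ^ 2 - 1 ≠ 0) :
    (2 : K) • cm (zE q a b c) (cm (zE q a b c) d q) q⁻¹ =
      (q - q⁻¹) • (zE q a b c * cm c d q * (a * b) + (a * b) * cm d c q⁻¹ * zE q a b c
        + (a * b) * c * cm (zE q a b c) d q + cm d (zE q a b c) q⁻¹ * c * (a * b)) := by
  rw [← sub_eq_zero]
  simp only [cm, zE]
  simp only [mul_assoc, mul_add, add_mul, mul_sub, sub_mul, smul_mul_assoc, mul_smul_comm,
      smul_add, smul_sub, smul_smul, neg_mul, mul_neg, smul_neg, h.db, h.db_x, h.da, h.da_x, h.ba,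
      h.ba_x, h.dcc, h.dcc_x, h.ccb, h.ccb_x, h.cbb, h.cbb_x, h.cca, h.cca_x, h.caa, h.caa_x,
      h.dcbc hs, h.dcbc_x hs, h.dcac hs, h.dcac_x hs, h.cbca hs, h.cbca_x hs, h.cabb hs, h.cabb_x
      hs, h.cacab hs, h.cacab_x hs, h.dcabcb hs, h.dcabcb_x hs, h.dcabca hs, h.dcabca_x hs]
  match_scalars <;> field_simp <;> ring

end D4Rules

theorem serre_cm {K A : Type*} [Field K] [Ring A] [Algebra K A] {q : K} (hq : q ≠ 0) {x y : A}
    (h : x * (x * y) = (q + q⁻¹) • (x * (y * x)) - y * (x * x)) :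
    D4Rules.cm x (D4Rules.cm x y q) q⁻¹ = 0 := by
  simp only [D4Rules.cm, mul_sub, sub_mul, smul_sub, mul_smul_comm, smul_mul_assoc, smul_smul,
    inv_mul_cancel₀ hq, one_smul, mul_assoc, h]
  module

theorem qq_ne : qq ≠ 0 := RatFunc.X_ne_zero

theorem qq_sq_sub : qq ^ 2 - 1 ≠ 0 := by
  intro h
  have h1 : (algebraMap (Polynomial ℂ) Kq) (Polynomial.X ^ 2 - Polynomial.C 1) = 0 := by
    simpa [qq, RatFunc.algebraMap_X] using h
  have h2 := (map_eq_zero_iff _ (RatFunc.algebraMap_injective ℂ)).1 h1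
  exact Polynomial.X_pow_sub_C_ne_zero (by norm_num) 1 h2

theorem qq_add_inv : qq + qq⁻¹ ≠ 0 := by
  intro h
  have h0 : qq ^ 2 + 1 = 0 := by
    have := congrArg (· * qq) h
    simp only [add_mul, inv_mul_cancel₀ qq_ne, zero_mul] at this
    rw [sq]; exact this
  have h1 : (algebraMap (Polynomial ℂ) Kq) (Polynomial.X ^ 2 + Polynomial.C 1) = 0 := by
    simpa [qq, RatFunc.algebraMap_X] using h0
  have h2 := (map_eq_zero_iff _ (RatFunc.algebraMap_injective ℂ)).1 h1
  exact Polynomial.X_pow_add_C_ne_zero (by norm_num) 1 h2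

theorem mE_comm (x y : DNode n) (hxy : x ≠ y) (h : ¬ adjD n x y) :
    mE n x * mE n y = mE n y * mE n x := by
  have := RingQuot.mkAlgHom_rel Kq (SORel.comm x y hxy h)
  simp only [map_mul] at this
  exact this

theorem mE_serre (x y : DNode n) (h : adjD n x y) :
    mE n x * (mE n x * mE n y) =
      (qq + qq⁻¹) • (mE n x * (mE n y * mE n x)) - mE n y * (mE n x * mE n x) := by
  have := RingQuot.mkAlgHom_rel Kq (SORel.serre x y h)
  simp only [map_mul, map_add, map_smul] at this
  change mE n x * mE n x * mE n y + mE n y * mE n x * mE n x =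
    (qq + qq⁻¹) • (mE n x * mE n y * mE n x) at this
  rw [eq_sub_iff_add_eq]
  simpa only [mul_assoc] using this

theorem mE_serre' (x y : DNode n) (h : adjD n x y) :
    mE n y * (mE n x * mE n x) =
      (qq + qq⁻¹) • (mE n x * (mE n y * mE n x)) - mE n x * (mE n x * mE n y) := by
  rw [mE_serre n x y h]; abel

theorem mE_rules (i j : Fin (n - 1)) (hi : (i : ℕ) = 0) (hj : (j : ℕ) = 1) :
    D4Rules (qq + qq⁻¹) (mE n .zer) (mE n .neg) (mE n (.pos i)) (mE n (.pos j)) where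
  db := mE_comm n _ _ (by simp) (by simp [adjD, hj])
  da := mE_comm n _ _ (by simp) (by simp [adjD, hj])
  ba := mE_comm n _ _ (by simp) (by simp [adjD])
  dcc := mE_serre' n _ _ (by simp [adjD, hi, hj])
  ccb := mE_serre n _ _ (by simp [adjD, hi])
  cbb := mE_serre' n _ _ (by simp [adjD, hi])
  cca := mE_serre n _ _ (by simp [adjD, hi])
  caa := mE_serre' n _ _ (by simp [adjD, hi])
  ddc := mE_serre n _ _ (by simp [adjD, hi, hj])

/-- The images of the generators. -/
def gImg (i0 : Fin (n - 1)) : UGen n → UqSO n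
  | .u i => mE n (.pos i)
  | .w => mE n .zer * mE n .neg
  | .z => D4Rules.zE qq (mE n .zer) (mE n .neg) (mE n (.pos i0))

theorem map_cmt {A B : Type*} [Ring A] [Algebra Kq A] [Ring B] [Algebra Kq B]
    (f : A →ₐ[Kq] B) (x y : A) (v : Kq) : f (cmt x y v) = D4Rules.cm (f x) (f y) v := by
  simp only [cmt, D4Rules.cm, map_sub, map_mul, map_smul]

theorem gImg_rel (i0 j0 : Fin (n - 1)) (hi0 : (i0 : ℕ) = 0) (hj0 : (j0 : ℕ) = 1)
    ⦃x y : FreeAlgebra Kq (UGen n)⦄ (h : URel n x y) :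
    FreeAlgebra.lift Kq (gImg n i0) x = FreeAlgebra.lift Kq (gImg n i0) y := by
  have R := mE_rules n i0 j0 hi0 hj0
  have hu : ∀ i, FreeAlgebra.lift Kq (gImg n i0) (fu n i) = mE n (.pos i) := fun i => by
    simp [fu, gImg]
  have hw : FreeAlgebra.lift Kq (gImg n i0) (fw n) = mE n .zer * mE n .neg := by
    simp [fw, gImg]
  have hz : FreeAlgebra.lift Kq (gImg n i0) (fz n) =
      D4Rules.zE qq (mE n .zer) (mE n .neg) (mE n (.pos i0)) := by
    simp [fz, gImg]
  have q0 := qq_ne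
  have q1 := qq_add_inv
  have q2 := qq_sq_sub
  have e0 : ∀ i : Fin (n - 1), (i : ℕ) = 0 → i = i0 := fun i hi => Fin.ext (hi.trans hi0.symm)
  have e1 : ∀ i : Fin (n - 1), (i : ℕ) = 1 → i = j0 := fun i hi => Fin.ext (hi.trans hj0.symm)
  induction h with
  | serre_u i j hij =>
    simp only [map_cmt, hu, map_zero]
    have hs := mE_serre n (.pos i) (.pos j) hij
    exact serre_cm q0 hs
  | comm_u i j hij =>
    simp only [map_mul, hu]
    refine mE_comm n _ _ ?_ ?_
    · intro h; injection h with h; subst h; omega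
    · simp only [adjD]; omega
  | comm_uw i hi =>
    simp only [map_mul, hu, hw]
    have h1 : Commute (mE n (.pos i)) (mE n .zer) := mE_comm n _ _ (by simp) (by simp [adjD, hi])
    have h2 : Commute (mE n (.pos i)) (mE n .neg) := mE_comm n _ _ (by simp) (by simp [adjD, hi])
    exact h1.mul_right h2
  | comm_uz i hi =>
    simp only [map_mul, hu, hz]
    by_cases h0 : (i : ℕ) = 0
    · rw [e0 i h0]
      exact R.cz q0 q1 q2
    · refine D4Rules.comm_z (mE_comm n _ _ (by simp) (by simp [adjD, h0]))
        (mE_comm n _ _ (by simp) (by simp [adjD, h0])) (mE_comm n _ _ ?_ ?_)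
      · intro h; injection h with h; subst h; omega
      · simp only [adjD]; omega
  | comm_zw =>
    simp only [map_mul, hw, hz]
    exact R.zw q0 q1 q2
  | serre_u1w i hi =>
    rw [e0 i hi]
    simp only [map_cmt, hu, hw, map_zero]
    exact R.u1w q0 q1 q2
  | serre_u2z i hi =>
    rw [e1 i hi]
    simp only [map_cmt, hu, hz, map_zero]
    exact R.u2z q0
  | rel_wwu i hi =>
    rw [e0 i hi]
    simp only [map_cmt, hu, hw, hz, map_neg, map_smul, map_mul]
    exact R.wwu q0 q1 q2
  | rel_zw i j hi hj =>
    rw [e0 i hi, e1 j hj]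
    simp only [map_cmt, hu, hw, hz]
    exact R.zw2 q0 q1 q2
  | rel_zz i j hi hj =>
    rw [e0 i hi, e1 j hj]
    simp only [map_cmt, hu, hw, hz, map_smul, map_mul, map_add]
    exact R.zz q0 q1 q2

/-- **The structural homomorphism `𝒰⁺_{q,n} → U_q^+(so_{2n+2})`** (Theorem on the folding
`(so_{2n+2}, sp_{2n})`): the assignment `u_i ↦ E_i`, `w ↦ E₀E₋₁`,
`z ↦ (q²−1)⁻¹([E₋₁,[E₁,E₀]_q]_q + [E₀,[E₁,E₋₁]_q]_q)` extends to an algebra homomorphism. -/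
theorem uqn_to_so_homomorphism (n : ℕ) (hn : 3 ≤ n) :
    ∃ f : UqnPlus n →ₐ[Kq] UqSO n,
      (∀ i : Fin (n - 1),
        f (RingQuot.mkAlgHom Kq (URel n) (fu n i)) = mE n (DNode.pos i)) ∧
      f (RingQuot.mkAlgHom Kq (URel n) (fw n)) = mE n DNode.zer * mE n DNode.neg ∧
      f (RingQuot.mkAlgHom Kq (URel n) (fz n)) =
        (qq ^ 2 - 1)⁻¹ •
          (cmt (mE n DNode.neg)
              (cmt (mE n (DNode.pos ⟨0, by omega⟩)) (mE n DNode.zer) qq) qq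
            + cmt (mE n DNode.zer)
              (cmt (mE n (DNode.pos ⟨0, by omega⟩)) (mE n DNode.neg) qq) qq) := by
  refine ⟨RingQuot.liftAlgHom Kq ⟨FreeAlgebra.lift Kq (gImg n ⟨0, by omega⟩),
    gImg_rel n ⟨0, by omega⟩ ⟨1, by omega⟩ rfl rfl⟩, ?_, ?_, ?_⟩
  · intro i
    rw [RingQuot.liftAlgHom_mkAlgHom_apply]
    simp [fu, gImg]
  · rw [RingQuot.liftAlgHom_mkAlgHom_apply]
    simp [fw, gImg]
  · rw [RingQuot.liftAlgHom_mkAlgHom_apply]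
    simp only [fz, FreeAlgebra.lift_ι_apply, gImg]
    rfl


end
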